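/- Let n ≥ 1 and let m be a nonnegative integer. Then, as an identity of rational functions in ℚ(x_1^{1/2},…,x_n^{1/2}), the Schur polynomial s_{(m^n)} in the 2n+1 variables (x_1, x_1^{−1}, …, x_n, x_n^{−1}, 1) equals so^B_{((m/2)^n)}(x_1,…,x_n) · sp_{((m/2)^n)}(x_1,…,x_n). -/

import Mathlib

open Matrix BigOperators
open scoped Classical

noncomputable section

/-- The field `ℚ(t_1, …, t_n)` of rational functions in `n` indeterminates over `ℚ`. -/
abbrev FF (n : ℕ) : Type := FractionRing (MvPolynomial (Fin n) ℚ)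

/-- The `i`-th indeterminate, viewed as an element of `FF n`. -/
def gen (n : ℕ) (i : Fin n) : FF n :=
  algebraMap (MvPolynomial (Fin n) ℚ) (FF n) (MvPolynomial.X i)

variable {F : Type*} [Field F]

/-- Symplectic character `sp_λ(x_1, …, x_N)`, in "doubled" form: `z i` represents
`x_i^{1/2}` and `μ i` represents `2·λ_i` (so half-integer weights are allowed). -/
def spD {N : ℕ} (z : Fin N → F) (μ : Fin N → ℤ) : F :=
  Matrix.det (Matrix.of fun i j : Fin N =>
      z j ^ (μ i + 2 * ((N : ℤ) - (i : ℕ))) - z j ^ (-(μ i + 2 * ((N : ℤ) - (i : ℕ))))) /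
  Matrix.det (Matrix.of fun i j : Fin N =>
      z j ^ (2 * ((N : ℤ) - (i : ℕ))) - z j ^ (-(2 * ((N : ℤ) - (i : ℕ)))))

/-- Odd orthogonal character `so^B_λ(x_1, …, x_N)`, in "doubled" form: `z i` represents
`x_i^{1/2}` and `μ i` represents `2·λ_i`. -/
def soBD {N : ℕ} (z : Fin N → F) (μ : Fin N → ℤ) : F :=
  Matrix.det (Matrix.of fun i j : Fin N =>
      z j ^ (μ i + 2 * ((N : ℤ) - (i : ℕ)) - 1) -
        z j ^ (-(μ i + 2 * ((N : ℤ) - (i : ℕ)) - 1))) /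
  Matrix.det (Matrix.of fun i j : Fin N =>
      z j ^ (2 * ((N : ℤ) - (i : ℕ)) - 1) - z j ^ (-(2 * ((N : ℤ) - (i : ℕ)) - 1)))

/-- Even orthogonal character `so^D_λ(x_1, …, x_N)`, in "doubled" form: `z i` represents
`x_i^{1/2}` and `μ i` represents `2·λ_i`; the factor is `2` if `λ_N > 0` and `1` otherwise. -/
def soDD {N : ℕ} (z : Fin N → F) (μ : Fin N → ℤ) : F :=
  (if h : 0 < N then (if 0 < μ ⟨N - 1, Nat.sub_lt h Nat.one_pos⟩ then (2 : F) else 1) else 1) *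
  (Matrix.det (Matrix.of fun i j : Fin N =>
      z j ^ (μ i + 2 * ((N : ℤ) - 1 - (i : ℕ))) +
        z j ^ (-(μ i + 2 * ((N : ℤ) - 1 - (i : ℕ))))) /
   Matrix.det (Matrix.of fun i j : Fin N =>
      z j ^ (2 * ((N : ℤ) - 1 - (i : ℕ))) + z j ^ (-(2 * ((N : ℤ) - 1 - (i : ℕ))))))

/-- The matrix `Ā_λ` of the bialternant formula for the intermediate symplectic character
`sp^{(k, N-k)}`, in "doubled" form: `z i` represents `x_i^{1/2}`, `μ i` represents `2·λ_i`. -/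
def interMatD {N : ℕ} (k : ℕ) (z : Fin N → F) (μ : Fin N → ℤ) : Matrix (Fin N) (Fin N) F :=
  Matrix.of fun i j : Fin N =>
    if (j : ℕ) < k then
      z j ^ (μ i + 2 * ((k : ℤ) - (i : ℕ))) /
          ∏ l ∈ Finset.univ.filter (fun l : Fin N => k ≤ (l : ℕ)), (1 - (z j ^ 2)⁻¹ * z l ^ 2) -
        z j ^ (-(μ i + 2 * ((k : ℤ) - (i : ℕ)))) /
          ∏ l ∈ Finset.univ.filter (fun l : Fin N => k ≤ (l : ℕ)), (1 - z j ^ 2 * z l ^ 2)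
    else z j ^ (μ i + 2 * ((N : ℤ) - 1 - (i : ℕ)))

/-- Intermediate symplectic character `sp^{(k, N-k)}_λ(x_1, …, x_k | x_{k+1}, …, x_N)`, in
"doubled" form: `z i` represents `x_i^{1/2}` and `μ i` represents `2·λ_i`. -/
def spInterD {N : ℕ} (k : ℕ) (z : Fin N → F) (μ : Fin N → ℤ) : F :=
  (interMatD k z μ).det / (interMatD k z fun _ => 0).det

/-- Symplectic character `sp_λ(z_1, …, z_N)` for an integer weight `μ`. -/
def spP {N : ℕ} (z : Fin N → F) (μ : Fin N → ℤ) : F :=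
  Matrix.det (Matrix.of fun i j : Fin N =>
      z j ^ (μ i + (N : ℤ) - (i : ℕ)) - z j ^ (-(μ i + (N : ℤ) - (i : ℕ)))) /
  Matrix.det (Matrix.of fun i j : Fin N =>
      z j ^ ((N : ℤ) - (i : ℕ)) - z j ^ (-((N : ℤ) - (i : ℕ))))

/-- The matrix `Ā_λ` of the bialternant formula for the intermediate symplectic character
`sp^{(k, N-k)}` with integer weight `μ`. -/
def interMatP {N : ℕ} (k : ℕ) (z : Fin N → F) (μ : Fin N → ℤ) : Matrix (Fin N) (Fin N) F :=
  Matrix.of fun i j : Fin N =>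
    if (j : ℕ) < k then
      z j ^ (μ i + (k : ℤ) - (i : ℕ)) /
          ∏ l ∈ Finset.univ.filter (fun l : Fin N => k ≤ (l : ℕ)), (1 - (z j)⁻¹ * z l) -
        z j ^ (-(μ i + (k : ℤ) - (i : ℕ))) /
          ∏ l ∈ Finset.univ.filter (fun l : Fin N => k ≤ (l : ℕ)), (1 - z j * z l)
    else z j ^ (μ i + (N : ℤ) - 1 - (i : ℕ))

/-- Intermediate symplectic character `sp^{(k, N-k)}_μ(z_1, …, z_k | z_{k+1}, …, z_N)`
for an integer weight `μ`. -/
def spInterP {N : ℕ} (k : ℕ) (z : Fin N → F) (μ : Fin N → ℤ) : F :=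
  (interMatP k z μ).det / (interMatP k z fun _ => 0).det

/-- Schur function `s_μ(z_1, …, z_N)` as a ratio of alternants (bialternant formula). -/
def schurP {N : ℕ} (z : Fin N → F) (μ : Fin N → ℤ) : F :=
  Matrix.det (Matrix.of fun i j : Fin N => z j ^ (μ i + (N : ℤ) - 1 - (i : ℕ))) /
  Matrix.det (Matrix.of fun i j : Fin N => z j ^ ((N : ℤ) - 1 - (i : ℕ)))

/-- Permuting rows and columns scales all determinants by a common nonzero factor. -/
theorem exists_det_submatrix_equiv {ι κ : Type*} [Fintype ι] [DecidableEq ι] [Fintype κ]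
    [DecidableEq κ] (r c : ι ≃ κ) :
    ∃ ε : F, ε ≠ 0 ∧ ∀ M : Matrix κ κ F, M.det = ε * (M.submatrix r c).det := by
  refine ⟨((Equiv.Perm.sign (r.symm.trans c) : ℤ) : F), ?_, fun M => ?_⟩
  · rcases Int.units_eq_one_or (Equiv.Perm.sign (r.symm.trans c)) with h | h <;> simp [h]
  · have h : M.submatrix r c = (M.submatrix id (r.symm.trans c)).submatrix r r := by
      ext i j
      simp
    rw [h, Matrix.det_submatrix_equiv_self, Matrix.det_permute', ← mul_assoc, ← Int.cast_mul,
      ← Units.val_mul, Int.units_mul_self]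
    simp

/-- A block determinant that factors after clearing the upper right block by a row operation
`E` and a column operation `G`. -/
theorem det_fromBlocks_of_clear {ι κ : Type*} [Fintype ι] [DecidableEq ι] [Fintype κ]
    [DecidableEq κ] (A : Matrix ι ι F) (B : Matrix ι κ F) (C : Matrix κ ι F) (D : Matrix κ κ F)
    (E G : Matrix ι κ F) (h : (A - E * C) * G + (B - E * D) = 0) :
    (Matrix.fromBlocks A B C D).det = (A - E * C).det * (C * G + D).det := by
  have key : Matrix.fromBlocks 1 (-E) 0 1 * Matrix.fromBlocks A B C D * Matrix.fromBlocks 1 G 0 1 =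
      Matrix.fromBlocks (A - E * C) 0 C (C * G + D) := by
    rw [Matrix.fromBlocks_multiply, Matrix.fromBlocks_multiply]
    congr 1 <;> simp [← sub_eq_add_neg, h]
  have hd := congrArg Matrix.det key
  simpa [Matrix.det_mul, Matrix.det_fromBlocks_zero₂₁, Matrix.det_fromBlocks_zero₁₂] using hd

/-- The determinant of even Laurent binomials bordered by a column of ones reduces to a
determinant of odd Laurent binomials. -/
theorem det_bordered_even {n : ℕ} (z : Fin n → F) (hz : ∀ j, z j ≠ 0) (m : ℤ) :
    (Matrix.of fun k l : Fin (n + 1) =>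
      (Fin.cons 1 (fun j => z j ^ (m + 2 * (k : ℕ)) + z j ^ (-(m + 2 * (k : ℕ)))) :
        Fin (n + 1) → F) l).det =
    (∏ j, (z j - (z j)⁻¹)) *
      (Matrix.of fun k j : Fin n =>
        z j ^ (m + 2 * (k : ℕ) + 1) - z j ^ (-(m + 2 * (k : ℕ) + 1))).det := by
  rw [Matrix.det_eq_of_forall_row_eq_smul_add_pred
    (B := Matrix.of (Fin.cons
      (Fin.cons 1 (fun j => z j ^ m + z j ^ (-m)) : Fin (n + 1) → F)
      (fun k : Fin n => (Fin.cons 0 (fun j => (z j - (z j)⁻¹) *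
        (z j ^ (m + 2 * (k : ℕ) + 1) - z j ^ (-(m + 2 * (k : ℕ) + 1)))) : Fin (n + 1) → F))))
    (c := fun _ => 1)]
  · rw [Matrix.det_succ_column_zero, Fin.sum_univ_succ, ← Matrix.det_mul_row]
    simp only [Matrix.of_apply, Fin.cons_zero, Fin.cons_succ, mul_zero, zero_mul,
      Finset.sum_const_zero, add_zero, Fin.val_zero, pow_zero, one_mul]
    congr 1
  · intro l
    refine Fin.cases ?_ (fun j => ?_) l <;> simp
  · intro k l
    refine Fin.cases ?_ (fun j => ?_) l
    · simp
    · have h := hz j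
      simp only [Matrix.of_apply, Fin.cons_succ, Fin.val_succ, Fin.val_castSucc]
      generalize (k : ℕ) = k
      have e1 : z j ^ (m + 2 * ((k + 1 : ℕ) : ℤ)) = z j ^ (m + 2 * (k : ℤ)) * z j * z j := by
        rw [← zpow_add_one₀ h, ← zpow_add_one₀ h]
        congr 1
        push_cast
        ring
      simp only [_root_.zpow_neg, zpow_add_one₀ h, e1]
      have h' : z j ^ (m + 2 * (k : ℤ)) ≠ 0 := zpow_ne_zero _ h
      field_simp
      ring

/-- Rows of the rectangular alternant, grouped by the long and short parts of the shape. -/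
def rectangleRowEquiv (n : ℕ) : Fin n ⊕ Fin (n + 1) ≃ Fin (2 * n + 1) :=
  Equiv.ofBijective
    (Sum.elim (fun k => ⟨n - 1 - k, by omega⟩) (fun l => ⟨n + l, by omega⟩)) <| by
    rw [Fintype.bijective_iff_injective_and_card]
    refine ⟨?_, by simp; ring⟩
    rintro (a | a) (b | b) h <;> simp [Fin.ext_iff] at h ⊢ <;> omega

/-- Columns of the rectangular alternant, grouped as `x_j` and then `1, x_j⁻¹`. -/
def rectangleColEquiv (n : ℕ) : Fin n ⊕ Fin (n + 1) ≃ Fin (2 * n + 1) :=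
  Equiv.ofBijective
    (Sum.elim (fun j => ⟨2 * j, by omega⟩)
      (Fin.cons ⟨2 * n, by omega⟩ (fun j : Fin n => ⟨2 * j + 1, by omega⟩))) <| by
    rw [Fintype.bijective_iff_injective_and_card]
    refine ⟨?_, by simp; ring⟩
    rintro (a | a) (b | b) h
    · simp [Fin.ext_iff] at h ⊢
      omega
    · revert h
      refine Fin.cases ?_ (fun b => ?_) b <;> simp [Fin.ext_iff] <;> omega
    · revert h
      refine Fin.cases ?_ (fun a => ?_) a <;> simp [Fin.ext_iff] <;> omega
    · revert h
      refine Fin.cases ?_ (fun a => ?_) a <;> refine Fin.cases ?_ (fun b => ?_) b <;>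
        simp [Fin.ext_iff] <;> omega

/-- The factorization of the symmetrized rectangular alternant. -/
theorem det_symmetrized_rectangle {n : ℕ} (z : Fin n → F) (hz : ∀ j, z j ≠ 0) (m : ℤ) :
    (Matrix.fromBlocks
      (Matrix.of fun k j : Fin n => z j ^ (m + 2 * (k : ℕ) + 2))
      (Matrix.of fun (k : Fin n) (l : Fin (n + 1)) =>
        (Fin.cons 1 (fun j => (z j)⁻¹) : Fin (n + 1) → F) l ^ (m + 2 * (k : ℕ) + 2))
      (Matrix.of fun (k : Fin (n + 1)) (j : Fin n) => z j ^ (-(m + 2 * (k : ℕ))))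
      (Matrix.of fun k l : Fin (n + 1) =>
        (Fin.cons 1 (fun j => (z j)⁻¹) : Fin (n + 1) → F) l ^ (-(m + 2 * (k : ℕ))))).det =
    (Matrix.of fun k j : Fin n =>
        z j ^ (m + 2 * (k : ℕ) + 2) - z j ^ (-(m + 2 * (k : ℕ) + 2))).det *
      ((∏ j, (z j - (z j)⁻¹)) *
        (Matrix.of fun k j : Fin n =>
          z j ^ (m + 2 * (k : ℕ) + 1) - z j ^ (-(m + 2 * (k : ℕ) + 1))).det) := by
  set E : Matrix (Fin n) (Fin (n + 1)) F := Matrix.of fun k l => if l = k.succ then 1 else 0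
    with hE
  have hEl : ∀ {κ : Type} (M : Matrix (Fin (n + 1)) κ F) k j, (E * M) k j = M k.succ j := by
    intro κ M k j
    simp [hE, Matrix.mul_apply]
  have hEr0 : ∀ {κ : Type} (M : Matrix κ (Fin n) F) k, (M * E) k 0 = 0 := by
    intro κ M k
    simp [hE, Matrix.mul_apply, (Fin.succ_ne_zero _).symm]
  have hErs : ∀ {κ : Type} (M : Matrix κ (Fin n) F) k (j : Fin n), (M * E) k j.succ = M k j := by
    intro κ M k j
    simp [hE, Matrix.mul_apply]
  have hs : ∀ k : ℕ, m + 2 * ((k + 1 : ℕ) : ℤ) = m + 2 * (k : ℤ) + 2 := by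
    intro k
    push_cast
    ring
  rw [det_fromBlocks_of_clear _ _ _ _ E E, ← det_bordered_even z hz]
  · congr 2
    · ext k j
      simp only [Matrix.sub_apply, hEl, Matrix.of_apply, Fin.val_succ, hs]
    · ext k l
      refine Fin.cases ?_ (fun j => ?_) l
      · simp [hEr0]
      · simp [hErs, add_comm]
  · ext k l
    refine Fin.cases ?_ (fun j => ?_) l
    · simp [hEr0, hEl]
    · simp only [Matrix.add_apply, Matrix.sub_apply, hErs, hEl, Matrix.of_apply, Fin.val_succ, hs,
        Fin.cons_succ, Matrix.zero_apply, _root_.inv_zpow', neg_neg]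
      ring

/-- The alternant of shape `(m^n)` in `x_1, x_1⁻¹, …, x_n, x_n⁻¹, 1` is, up to a nonzero factor
independent of `m`, the product of an odd orthogonal and a symplectic alternant. -/
theorem exists_det_rectangle_factor {n : ℕ} (z : Fin n → F) (hz : ∀ j, z j ≠ 0)
    (hz' : ∀ j, z j - (z j)⁻¹ ≠ 0) (y : Fin (2 * n + 1) → F)
    (hy : ∀ s, y (rectangleColEquiv n s) =
      Sum.elim (fun j => z j ^ 2) (Fin.cons 1 (fun j => (z j ^ 2)⁻¹)) s) :
    ∃ c : F, c ≠ 0 ∧ ∀ m : ℤ,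
      (Matrix.of fun i j : Fin (2 * n + 1) =>
        y j ^ ((if (i : ℕ) < n then m else 0) + ((2 * n + 1 : ℕ) : ℤ) - 1 - (i : ℕ))).det =
      c * ((Matrix.of fun i j : Fin n =>
          z j ^ (m + 2 * ((n : ℤ) - (i : ℕ)) - 1) -
            z j ^ (-(m + 2 * ((n : ℤ) - (i : ℕ)) - 1))).det *
        (Matrix.of fun i j : Fin n =>
          z j ^ (m + 2 * ((n : ℤ) - (i : ℕ))) - z j ^ (-(m + 2 * ((n : ℤ) - (i : ℕ))))).det) := by
  obtain ⟨ε, hε, hdet⟩ :=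
    exists_det_submatrix_equiv (F := F) (rectangleRowEquiv n) (rectangleColEquiv n)
  obtain ⟨δ, hδ, hrev⟩ :=
    exists_det_submatrix_equiv (F := F) (Fin.revPerm (n := n)) (Equiv.refl _)
  refine ⟨ε * (∏ j, (z j - (z j)⁻¹)) * (δ⁻¹ * δ⁻¹), ?_, fun m => ?_⟩
  · have := Finset.prod_ne_zero_iff.2 (fun j (_ : j ∈ Finset.univ) => hz' j)
    positivity
  have hrow : ∀ k : Fin n, (n : ℤ) - ((Fin.revPerm k : Fin n) : ℕ) = k + 1 := by
    intro k
    simp only [Fin.revPerm_apply, Fin.val_rev]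
    omega
  rw [hdet, hrev (Matrix.of fun i j : Fin n =>
      z j ^ (m + 2 * ((n : ℤ) - (i : ℕ)) - 1) - z j ^ (-(m + 2 * ((n : ℤ) - (i : ℕ)) - 1))),
    hrev (Matrix.of fun i j : Fin n =>
      z j ^ (m + 2 * ((n : ℤ) - (i : ℕ))) - z j ^ (-(m + 2 * ((n : ℤ) - (i : ℕ)))))]
  have hso : (Matrix.of fun i j : Fin n =>
      z j ^ (m + 2 * ((n : ℤ) - (i : ℕ)) - 1) -
        z j ^ (-(m + 2 * ((n : ℤ) - (i : ℕ)) - 1))).submatrix Fin.revPerm (Equiv.refl _) =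
      Matrix.of fun k j : Fin n =>
        z j ^ (m + 2 * (k : ℕ) + 1) - z j ^ (-(m + 2 * (k : ℕ) + 1)) := by
    ext k j
    have : m + 2 * ((k : ℤ) + 1) - 1 = m + 2 * (k : ℕ) + 1 := by ring
    simp only [Matrix.submatrix_apply, Matrix.of_apply, Equiv.refl_apply, hrow, this]
  have hsp : (Matrix.of fun i j : Fin n =>
      z j ^ (m + 2 * ((n : ℤ) - (i : ℕ))) -
        z j ^ (-(m + 2 * ((n : ℤ) - (i : ℕ))))).submatrix Fin.revPerm (Equiv.refl _) =
      Matrix.of fun k j : Fin n =>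
        z j ^ (m + 2 * (k : ℕ) + 2) - z j ^ (-(m + 2 * (k : ℕ) + 2)) := by
    ext k j
    have : m + 2 * ((k : ℤ) + 1) = m + 2 * (k : ℕ) + 2 := by ring
    simp only [Matrix.submatrix_apply, Matrix.of_apply, Equiv.refl_apply, hrow, this]
  rw [hso, hsp]
  set v : Fin n ⊕ Fin (n + 1) → F :=
    Sum.elim (fun j => z j ^ (-(m + 2 * n))) (Fin.cons 1 (fun j => z j ^ (m + 2 * n))) with hv
  have hprod : ∏ s, v s = 1 := by
    rw [Fintype.prod_sum_type]
    simp only [hv, Sum.elim_inl, Sum.elim_inr, Fin.prod_univ_succ, Fin.cons_zero, Fin.cons_succ,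
      one_mul]
    rw [← Finset.prod_mul_distrib]
    exact Finset.prod_eq_one fun j _ => by rw [← zpow_add₀ (hz j)]; simp
  rw [← one_mul (Matrix.det (Matrix.submatrix _ (rectangleRowEquiv n) _)), ← hprod,
    ← Matrix.det_mul_row]
  have hrowl : ∀ k : Fin n, ((rectangleRowEquiv n (Sum.inl k) : Fin _) : ℕ) = n - 1 - k :=
    fun _ => rfl
  have hrowr : ∀ l : Fin (n + 1), ((rectangleRowEquiv n (Sum.inr l) : Fin _) : ℕ) = n + l :=
    fun _ => rfl
  have hexpl : ∀ k : Fin n, (if n - 1 - (k : ℕ) < n then m else 0) + ((2 * n + 1 : ℕ) : ℤ) - 1 -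
      ((n - 1 - (k : ℕ) : ℕ) : ℤ) = m + n + 1 + k := by
    intro k
    rw [if_pos (by omega)]
    omega
  have hexpr : ∀ l : Fin (n + 1), (if n + (l : ℕ) < n then m else 0) + ((2 * n + 1 : ℕ) : ℤ) - 1 -
      ((n + (l : ℕ) : ℕ) : ℤ) = n - l := by
    intro l
    rw [if_neg (by omega)]
    push_cast
    ring
  have hmain := det_symmetrized_rectangle z hz m
  have hsq : ∀ (x : F) (a : ℤ), (x ^ 2) ^ a = x ^ (2 * a) := by
    intro x a
    rw [_root_.zpow_mul, zpow_ofNat]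
  rw [show (Matrix.of fun i j => v j * (Matrix.of fun i j : Fin (2 * n + 1) =>
      y j ^ ((if (i : ℕ) < n then m else 0) + ((2 * n + 1 : ℕ) : ℤ) - 1 - (i : ℕ))).submatrix
        (rectangleRowEquiv n) (rectangleColEquiv n) i j) = Matrix.fromBlocks _ _ _ _ from ?_,
    hmain]
  · field_simp
  · ext s t
    rcases s with k | k <;> rcases t with l | l <;>
      [skip; refine Fin.cases ?_ (fun j => ?_) l; skip; refine Fin.cases ?_ (fun j => ?_) l] <;>
      simp only [Matrix.of_apply, Matrix.submatrix_apply, hy, hrowl, hrowr, hexpl, hexpr, hv,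
        Sum.elim_inl, Sum.elim_inr, Fin.cons_zero, Fin.cons_succ, _root_.one_zpow, mul_one,
        Matrix.fromBlocks_apply₁₁, Matrix.fromBlocks_apply₁₂, Matrix.fromBlocks_apply₂₁,
        Matrix.fromBlocks_apply₂₂, ← inv_pow, hsq, _root_.inv_zpow', neg_neg] <;>
      try rw [← zpow_add₀ (hz _)] <;> congr 1 <;> ring

theorem gen_ne_zero (n : ℕ) (i : Fin n) : gen n i ≠ 0 := by
  simp [gen, MvPolynomial.X_ne_zero]

theorem gen_sub_inv_ne_zero (n : ℕ) (i : Fin n) : gen n i - (gen n i)⁻¹ ≠ 0 := by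
  intro h
  have h1 : gen n i * gen n i = 1 := by
    rw [sub_eq_zero] at h
    nth_rewrite 2 [h]
    exact mul_inv_cancel₀ (gen_ne_zero n i)
  rw [gen, ← map_mul, ← map_one (algebraMap (MvPolynomial (Fin n) ℚ) (FF n))] at h1
  have h2 := congrArg (MvPolynomial.eval 0)
    (IsFractionRing.injective (MvPolynomial (Fin n) ℚ) (FF n) h1)
  simp at h2

/-- **Factorization.**  For `n ≥ 1` and a nonnegative integer `m`, the Schur function of shape
`(m^n)` in the `2n+1` variables `(x_1, x_1^{-1}, …, x_n, x_n^{-1}, 1)` equals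
`so^B_{((m/2)^n)}(x_1,…,x_n) · sp_{((m/2)^n)}(x_1,…,x_n)`, as an identity in
`ℚ(x_1^{1/2}, …, x_n^{1/2})`.  Here `gen n i` plays the role of `x_i^{1/2}` (so
`x_i = (gen n i)^2`), and the weights of `soBD` and `spD` are doubled. -/
theorem schur_rectangle_factor_soB_sp (n m : ℕ) (hn : 1 ≤ n) :
    schurP
      (fun j : Fin (2 * n + 1) =>
        if h : (j : ℕ) = 2 * n then (1 : FF n)
        else if (j : ℕ) % 2 = 0 then gen n ⟨(j : ℕ) / 2, by have := j.isLt; omega⟩ ^ 2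
        else (gen n ⟨(j : ℕ) / 2, by have := j.isLt; omega⟩ ^ 2)⁻¹)
      (fun j => if (j : ℕ) < n then (m : ℤ) else 0) =
    soBD (gen n) (fun _ => (m : ℤ)) * spD (gen n) (fun _ => (m : ℤ)) := by
  set y : Fin (2 * n + 1) → FF n := fun j =>
    if h : (j : ℕ) = 2 * n then (1 : FF n)
    else if (j : ℕ) % 2 = 0 then gen n ⟨(j : ℕ) / 2, by have := j.isLt; omega⟩ ^ 2
    else (gen n ⟨(j : ℕ) / 2, by have := j.isLt; omega⟩ ^ 2)⁻¹ with hy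
  obtain ⟨c, hc, hdet⟩ := exists_det_rectangle_factor (gen n) (gen_ne_zero n)
    (gen_sub_inv_ne_zero n) y (by
      rintro (j | l)
      · have h : 2 * (j : ℕ) ≠ 2 * n := by omega
        simp [hy, rectangleColEquiv, h]
      · refine Fin.cases ?_ (fun j => ?_) l
        · simp [hy, rectangleColEquiv]
        · have h : 2 * (j : ℕ) + 1 ≠ 2 * n := by omega
          have h2 : (2 * (j : ℕ) + 1) / 2 = j := by omega
          simp [hy, rectangleColEquiv, h, h2, Nat.add_mod])
  have h0 := hdet 0
  simp only [ite_self, zero_add] at h0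
  rw [schurP, hdet m, h0, mul_div_mul_left _ _ hc, soBD, spD, div_mul_div_comm]
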